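/- Let N ≥ 2 be an even integer and k = N/2. Then there exists v ∈ X_1 with ‖v‖_{X_1} = 1 such that ∫₀¹ r^{N−1} exp(μ_N |v(r)|^{(N+2)/N}) dr > (1/N)·(1 + e^{H_k}), where H_k = ∑_{i=1}^{k} 1/i. In particular, sup { ∫₀¹ r^{N−1} exp(μ_N |v(r)|^{(N+2)/N}) dr : v ∈ X_1, ‖v‖_{X_1} = 1 } > (1/N)·(1 + e^{H_k}). -/

import Mathlib

open MeasureTheory Real Set Filter
open scoped ENNReal

/-- Surface area of the unit sphere in `ℝ^N` (equals `N` times the volume of the unit ball). -/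
noncomputable def omegaS (N : ℕ) : ℝ :=
  N * (volume (Metric.ball (0 : EuclideanSpace ℝ (Fin N)) 1)).toReal

/-- The normalising constant `c_N = ω_{N-1} · binom(N,k) / N`. -/
noncomputable def cN (N k : ℕ) : ℝ := omegaS N * (N.choose k) / N

/-- The critical constant `μ_N = N · (ω_{N-1} · binom(N-1,k-1) / k)^{2/N}`. -/
noncomputable def muN (N k : ℕ) : ℝ :=
  N * (omegaS N * ((N - 1).choose (k - 1)) / k) ^ ((2 : ℝ) / N)

/-- Membership in the weighted space `X₁`: `v` is locally absolutely continuous on `(0,1)`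
with derivative `v'` (in the sense of the fundamental theorem of calculus),
`v(r) → 0` as `r → 1⁻`, and the two defining weighted integrals are finite. -/
structure MemX1 (N k : ℕ) (v v' : ℝ → ℝ) : Prop where
  locAC : ∀ a ∈ Ioo (0:ℝ) 1, ∀ b ∈ Ioo (0:ℝ) 1,
    IntervalIntegrable v' volume a b ∧ v b - v a = ∫ t in a..b, v' t
  lim_one : Tendsto v (nhdsWithin 1 (Iio 1)) (nhds 0)
  grad_int : ∫⁻ r in Ioo (0:ℝ) 1, ENNReal.ofReal (r ^ (N - k) * |v' r| ^ (k + 1)) < ⊤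
  fun_int : ∫⁻ r in Ioo (0:ℝ) 1, ENNReal.ofReal (r ^ (N - 1) * |v r| ^ (k + 1)) < ⊤

/-- The norm on `X₁`: `‖v‖ = (c_N ∫₀¹ r^{N-k} |v'|^{k+1} dr)^{1/(k+1)}`. -/
noncomputable def normX1 (N k : ℕ) (v' : ℝ → ℝ) : ℝ :=
  (cN N k * ∫ r in Ioo (0:ℝ) 1, r ^ (N - k) * |v' r| ^ (k + 1)) ^ (1 / (k + 1 : ℝ))

/-- `e^{H_k} ≤ e^{3/2} (k + 1/2) / (5/2)` for `k ≥ 2`. -/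
theorem exp_harmonic_le (k : ℕ) (hk : 2 ≤ k) :
    exp (∑ i ∈ Finset.range k, (1 : ℝ) / (i + 1)) ≤ exp (3 / 2) * ((k + 1 / 2) / (5 / 2)) := by
  induction k, hk using Nat.le_induction with
  | base => norm_num [Finset.sum_range_succ]
  | succ k hk ih =>
    rw [Finset.sum_range_succ, exp_add]
    have hk0 : (0 : ℝ) < k + 1 / 2 := by positivity
    have h : exp ((1 : ℝ) / (k + 1)) ≤ 1 + 1 / (k + 1 / 2) := by
      rw [← le_log_iff_exp_le (by positivity)]
      refine le_trans (le_of_eq ?_) (le_log_one_add_of_nonneg (by positivity))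
      field_simp
      ring
    calc _ ≤ (exp (3 / 2) * ((k + 1 / 2) / (5 / 2))) * (1 + 1 / (k + 1 / 2)) := by gcongr
      _ = _ := by push_cast; field_simp; ring

theorem exp_one_le_one_add_inv_pow (k : ℕ) (hk : 2 ≤ k) :
    exp 1 - 1 ≤ (((k : ℝ) + 1) / k) ^ (k + 1) - ((k : ℝ) + 1) / k := by
  have hk' : (2 : ℝ) ≤ k := by exact_mod_cast hk
  have h1 : 1 + 1 / (2 * (k : ℝ) + 1) ≤ ((k + 1 : ℕ) : ℝ) * log (1 + 1 / k) := by
    calc _ = ((k + 1 : ℕ) : ℝ) * (2 * (1 / (k : ℝ)) / (1 / k + 2)) := by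
          push_cast; field_simp; ring
      _ ≤ _ := by gcongr; exact le_log_one_add_of_nonneg (by positivity)
  have h2 : exp 1 * (1 + 1 / (2 * (k : ℝ) + 1)) ≤ (((k : ℝ) + 1) / k) ^ (k + 1) := by
    calc _ ≤ exp 1 * exp (1 / (2 * (k : ℝ) + 1)) := by
          gcongr; linarith [add_one_le_exp (1 / (2 * (k : ℝ) + 1))]
      _ = exp (1 + 1 / (2 * (k : ℝ) + 1)) := by rw [exp_add]
      _ ≤ exp (((k + 1 : ℕ) : ℝ) * log (1 + 1 / k)) := by gcongr
      _ = _ := by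
          rw [exp_nat_mul, exp_log (by positivity)]
          congr 1; field_simp
  have h3 : 1 / (k : ℝ) ≤ exp 1 * (1 / (2 * (k : ℝ) + 1)) := by
    rw [mul_one_div, div_le_div_iff₀ (by positivity) (by positivity)]
    nlinarith [exp_one_gt_d9]
  have h4 : ((k : ℝ) + 1) / k = 1 + 1 / k := by field_simp
  rw [h4] at h2 ⊢
  linarith

theorem carleson_chang_numeric (k : ℕ) (hk : 0 < k) :
    1 + exp (∑ i ∈ Finset.range k, (1 : ℝ) / (i + 1)) <
      ((k : ℝ) + 1) * exp (-((3 * k + 1) / (4 * k + 2))) +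
        (k * exp ((((k : ℝ) + 1) / k) ^ (k + 1) - ((k : ℝ) + 1) / k) - k) * exp (-1) + exp (-1) := by
  have he := exp_one_lt_d9
  have he' := exp_one_gt_d9
  set S := exp (∑ i ∈ Finset.range k, (1 : ℝ) / (i + 1)) with hS
  set E := exp ((((k : ℝ) + 1) / k) ^ (k + 1) - ((k : ℝ) + 1) / k) with hE
  have hkr : (1 : ℝ) ≤ k := by exact_mod_cast hk
  suffices h : exp 1 + exp 1 * S < ((k : ℝ) + 1) * exp ((k + 1) / (4 * k + 2)) + k * (E - 1) + 1 by
    have h1 : exp (-((3 * (k : ℝ) + 1) / (4 * k + 2))) = exp ((k + 1) / (4 * k + 2)) * exp (-1) := by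
      rw [← exp_add]; congr 1; field_simp; ring
    have h2 : exp 1 * exp (-1) = 1 := by rw [← exp_add]; simp
    have h3 := mul_lt_mul_of_pos_right h (exp_pos (-1))
    rw [h1]
    linear_combination h3 - (1 + S) * h2
  have hsq (x : ℝ) (hx : 0 ≤ x) :
      1 + x + x ^ 2 / 2 + x ^ 3 / 6 + x ^ 4 / 24 ≤ exp x := by
    refine le_trans (le_of_eq ?_) (sum_le_exp_of_nonneg hx 5)
    simp [Finset.sum_range_succ, Nat.factorial]
  have h52 : exp (5 / 2) < 12.19 := by
    have : exp (5 / 2) ^ 2 = exp 1 ^ 5 := by rw [← exp_nat_mul, ← exp_nat_mul]; norm_num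
    have h5 : exp 1 ^ 5 < 12.19 ^ 2 := by
      calc exp 1 ^ 5 < 2.7182818286 ^ 5 := by gcongr
        _ < _ := by norm_num
    exact lt_of_pow_lt_pow_left₀ 2 (by norm_num) (this ▸ h5)
  rcases (show k = 1 ∨ k = 2 ∨ 3 ≤ k by omega) with rfl | rfl | h3
  · have hS1 : S = exp 1 := by simp [hS]
    have hE1 : E = exp 1 * exp 1 := by rw [hE, ← exp_add]; norm_num
    rw [hS1, hE1]
    have := hsq (1 / 3) (by norm_num)
    norm_num at this ⊢
    linarith
  · have hS1 : exp 1 * S = exp (5 / 2) := by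
      rw [hS, ← exp_add]; norm_num [Finset.sum_range_succ]
    have hE1 : E = exp 1 * exp (7 / 8) := by rw [hE, ← exp_add]; norm_num
    rw [hS1, hE1]
    have h1 := hsq (3 / 10) (by norm_num)
    have h2 := hsq (7 / 8) (by norm_num)
    norm_num at h1 h2 ⊢
    nlinarith
  · have hS1 : exp 1 * S ≤ exp (5 / 2) * ((k + 1 / 2) / (5 / 2)) := by
      calc _ ≤ exp 1 * (exp (3 / 2) * ((k + 1 / 2) / (5 / 2))) := by
            gcongr; exact exp_harmonic_le k (by omega)
        _ = _ := by rw [← mul_assoc, ← exp_add]; norm_num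
    have hE1 : 5.56 ≤ E := by
      calc (5.56 : ℝ) ≤ exp 1 * exp 0.718 := by
            have h2 := hsq 0.718 (by norm_num)
            norm_num at h2 ⊢
            nlinarith
        _ = exp 1.718 := by rw [← exp_add]; norm_num
        _ ≤ E := by
            rw [hE]; gcongr
            linarith [exp_one_le_one_add_inv_pow k (by omega)]
    have h1 : 1.284 ≤ exp (((k : ℝ) + 1) / (4 * k + 2)) := by
      calc (1.284 : ℝ) ≤ exp (1 / 4) := by
            refine le_trans ?_ (hsq (1 / 4) (by norm_num)); norm_num
        _ ≤ _ := by
            rw [exp_le_exp, div_le_div_iff₀ (by norm_num) (by positivity)]; linarith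
    have h3 : (3 : ℝ) ≤ k := by exact_mod_cast h3
    nlinarith

/-- The profile of Carleson and Chang in the logarithmic variable: linear, then a root, then constant. -/
noncomputable def moserProfile (k : ℕ) (T t : ℝ) : ℝ :=
  if t ≤ k + 1 then (k : ℝ) ^ ((k : ℝ) / (k + 1)) / (k + 1) * t
  else (min t T - 1) ^ ((k : ℝ) / (k + 1))

/-- The derivative of `moserProfile`. -/
noncomputable def moserSlope (k : ℕ) (T t : ℝ) : ℝ :=
  if t ≤ k + 1 then (k : ℝ) ^ ((k : ℝ) / (k + 1)) / (k + 1)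
  else if t ≤ T then (k : ℝ) / (k + 1) * (t - 1) ^ ((k : ℝ) / (k + 1) - 1) else 0

/-- The point from which on the profile is constant. -/
noncomputable def moserEnd (k : ℕ) : ℝ :=
  1 + k * exp ((((k : ℝ) + 1) / k) ^ (k + 1) - ((k : ℝ) + 1) / k)

theorem lt_moserEnd {k : ℕ} (hk : 0 < k) : (k : ℝ) + 1 < moserEnd k := by
  have hk' : (0 : ℝ) < k := by exact_mod_cast hk
  have h1 : 1 < ((k : ℝ) + 1) / k := by rw [lt_div_iff₀ hk']; linarith
  have h2 : ((k : ℝ) + 1) / k < (((k : ℝ) + 1) / k) ^ (k + 1) := by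
    simpa using pow_lt_pow_right₀ h1 (show 1 < k + 1 by omega)
  have h3 : 1 < exp ((((k : ℝ) + 1) / k) ^ (k + 1) - ((k : ℝ) + 1) / k) := by
    rw [one_lt_exp_iff]; linarith
  unfold moserEnd
  nlinarith

theorem continuous_moserProfile {k : ℕ} (hk : 0 < k) {T : ℝ} (hT : (k : ℝ) + 1 < T) :
    Continuous (moserProfile k T) := by
  have hk' : (0 : ℝ) < k := by exact_mod_cast hk
  refine Continuous.if_le (by fun_prop) ?_ continuous_id continuous_const ?_
  · exact (by fun_prop : Continuous fun t : ℝ => min t T - 1).rpow_const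
      fun _ => Or.inr (by positivity)
  · rintro t (rfl : t = _)
    rw [min_eq_left hT.le, add_sub_cancel_right]
    field_simp

theorem hasDerivAt_moserProfile {k : ℕ} (hk : 0 < k) {T t : ℝ} (hT : (k : ℝ) + 1 < T)
    (h1 : t ≠ k + 1) (h2 : t ≠ T) : HasDerivAt (moserProfile k T) (moserSlope k T t) t := by
  have hk' : (0 : ℝ) < k := by exact_mod_cast hk
  rcases lt_or_gt_of_ne h1 with h | h
  · have e : moserProfile k T =ᶠ[nhds t] fun t => (k : ℝ) ^ ((k : ℝ) / (k + 1)) / (k + 1) * t := by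
      filter_upwards [Iio_mem_nhds h] with x hx
      rw [moserProfile, if_pos (le_of_lt hx)]
    rw [moserSlope, if_pos h.le]
    refine HasDerivAt.congr_of_eventuallyEq ?_ e
    simpa using (hasDerivAt_id t).const_mul ((k : ℝ) ^ ((k : ℝ) / (k + 1)) / (k + 1))
  rw [moserSlope, if_neg (not_le.2 h)]
  rcases lt_or_gt_of_ne h2 with h' | h'
  · have e : moserProfile k T =ᶠ[nhds t] fun t => (t - 1) ^ ((k : ℝ) / (k + 1)) := by
      filter_upwards [Ioo_mem_nhds h h'] with x hx
      rw [moserProfile, if_neg (not_le.2 hx.1), min_eq_left hx.2.le]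
    rw [if_pos h'.le]
    refine HasDerivAt.congr_of_eventuallyEq ?_ e
    have := ((hasDerivAt_id t).sub_const 1).rpow_const (p := (k : ℝ) / (k + 1))
      (Or.inl (by simp only [id]; linarith))
    simpa using this
  · have e : moserProfile k T =ᶠ[nhds t] fun _ => (T - 1) ^ ((k : ℝ) / (k + 1)) := by
      filter_upwards [Ioi_mem_nhds h'] with x hx
      rw [moserProfile, if_neg (not_le.2 (hT.trans hx)), min_eq_right (le_of_lt hx)]
    rw [if_neg (not_le.2 h')]
    exact (hasDerivAt_const _ _).congr_of_eventuallyEq e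

theorem moserProfile_nonneg {k : ℕ} (hk : 0 < k) {T t : ℝ} (hT : (k : ℝ) + 1 < T) (ht : 0 ≤ t) :
    0 ≤ moserProfile k T t := by
  have hk' : (0 : ℝ) < k := by exact_mod_cast hk
  unfold moserProfile
  split_ifs with h
  · positivity
  · refine rpow_nonneg ?_ _
    rw [sub_nonneg, le_min_iff]
    constructor <;> linarith

theorem moserProfile_le {k : ℕ} (hk : 0 < k) {T t : ℝ} (hT : (k : ℝ) + 1 < T) :
    moserProfile k T t ≤ (T - 1) ^ ((k : ℝ) / (k + 1)) := by
  have hk' : (0 : ℝ) < k := by exact_mod_cast hk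
  unfold moserProfile
  split_ifs with h
  · calc _ ≤ (k : ℝ) ^ ((k : ℝ) / (k + 1)) / (k + 1) * (k + 1) := by gcongr
      _ = (k : ℝ) ^ ((k : ℝ) / (k + 1)) := by field_simp
      _ ≤ _ := by gcongr; linarith
  · have : 0 ≤ min t T - 1 := by rw [sub_nonneg, le_min_iff]; constructor <;> linarith
    gcongr
    exact min_le_right _ _

theorem measurable_moserSlope (k : ℕ) (T : ℝ) : Measurable (moserSlope k T) := by
  unfold moserSlope
  exact Measurable.ite measurableSet_Iic measurable_const
    (Measurable.ite measurableSet_Iic (by fun_prop) measurable_const)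

theorem moserSlope_nonneg (k : ℕ) (T t : ℝ) : 0 ≤ moserSlope k T t := by
  unfold moserSlope
  split_ifs with h
  · positivity
  · have : (0 : ℝ) ≤ t - 1 := by
      have : (0 : ℝ) ≤ k := by positivity
      linarith
    positivity
  · rfl

theorem moserSlope_le_one {k : ℕ} (hk : 0 < k) (T t : ℝ) : moserSlope k T t ≤ 1 := by
  have hk' : (1 : ℝ) ≤ k := by exact_mod_cast hk
  unfold moserSlope
  split_ifs with h
  · rw [div_le_one (by positivity)]
    calc (k : ℝ) ^ ((k : ℝ) / (k + 1)) ≤ (k : ℝ) ^ (1 : ℝ) := by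
          refine rpow_le_rpow_of_exponent_le hk' ?_
          rw [div_le_one (by positivity)]; linarith
      _ ≤ _ := by simp
  · have h1 : (k : ℝ) / (k + 1) ≤ 1 := by rw [div_le_one (by positivity)]; linarith
    have h2 : (t - 1) ^ ((k : ℝ) / (k + 1) - 1) ≤ 1 :=
      rpow_le_one_of_one_le_of_nonpos (by linarith) (by linarith)
    calc _ ≤ (1 : ℝ) * 1 := mul_le_mul h1 h2 (rpow_nonneg (by linarith) _) zero_le_one
      _ = 1 := one_mul 1
  · exact zero_le_one

theorem setLIntegral_Ioi_split (F : ℝ → ℝ≥0∞) {a T : ℝ} (ha : 0 < a) (hT : a < T) :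
    ∫⁻ t in Ioi 0, F t =
      (∫⁻ t in Ioc 0 a, F t) + (∫⁻ t in Ioc a T, F t) + ∫⁻ t in Ioi T, F t := by
  rw [← Ioc_union_Ioi_eq_Ioi (ha.trans hT).le, lintegral_union measurableSet_Ioi,
    ← Ioc_union_Ioc_eq_Ioc ha.le hT.le, lintegral_union measurableSet_Ioc]
  · exact Ioc_disjoint_Ioc_of_le le_rfl
  · exact Set.disjoint_left.2 fun x hx hx' => not_lt.2 hx.2 hx'

theorem setLIntegral_Ioc_ofReal {f : ℝ → ℝ} {a b : ℝ} (hab : a ≤ b)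
    (hf : ContinuousOn f (Icc a b)) (h0 : ∀ t ∈ Ioc a b, 0 ≤ f t) :
    ∫⁻ t in Ioc a b, ENNReal.ofReal (f t) = ENNReal.ofReal (∫ t in a..b, f t) := by
  rw [intervalIntegral.integral_of_le hab, ofReal_integral_eq_lintegral_ofReal]
  · exact hf.integrableOn_Icc.mono_set Ioc_subset_Icc_self
  · exact (ae_restrict_iff' measurableSet_Ioc).2 (ae_of_all _ h0)

theorem lintegral_moserSlope_pow {k : ℕ} (hk : 0 < k) :
    ∫⁻ t in Ioi 0, ENNReal.ofReal (moserSlope k (moserEnd k) t ^ (k + 1)) = 1 := by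
  have hk' : (0 : ℝ) < k := by exact_mod_cast hk
  have hT := lt_moserEnd hk
  rw [setLIntegral_Ioi_split _ (by positivity) hT]
  have e1 : ∫⁻ t in Ioc 0 ((k : ℝ) + 1), ENNReal.ofReal (moserSlope k (moserEnd k) t ^ (k + 1)) =
      ENNReal.ofReal (((k : ℝ) / (k + 1)) ^ k) := by
    have : ∀ t ∈ Ioc 0 ((k : ℝ) + 1), ENNReal.ofReal (moserSlope k (moserEnd k) t ^ (k + 1)) =
        ENNReal.ofReal ((k : ℝ) ^ k / (k + 1) ^ (k + 1)) := by
      intro t ht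
      rw [moserSlope, if_pos ht.2, div_pow, ← rpow_mul_natCast hk'.le]
      push_cast
      rw [div_mul_cancel₀ _ (by positivity), rpow_natCast]
    rw [setLIntegral_congr_fun measurableSet_Ioc this,
      setLIntegral_Ioc_ofReal (by positivity) continuousOn_const (fun _ _ => by positivity)]
    congr 1
    rw [intervalIntegral.integral_const, smul_eq_mul, div_pow]
    field_simp
    ring
  have e2 : ∫⁻ t in Ioc ((k : ℝ) + 1) (moserEnd k),
      ENNReal.ofReal (moserSlope k (moserEnd k) t ^ (k + 1)) =
      ENNReal.ofReal (1 - ((k : ℝ) / (k + 1)) ^ k) := by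
    have : ∀ t ∈ Ioc ((k : ℝ) + 1) (moserEnd k),
        ENNReal.ofReal (moserSlope k (moserEnd k) t ^ (k + 1)) =
        ENNReal.ofReal (((k : ℝ) / (k + 1)) ^ (k + 1) * (t - 1)⁻¹) := by
      intro t ht
      have h1 : 0 < t - 1 := by linarith [ht.1]
      rw [moserSlope, if_neg (not_le.2 ht.1), if_pos ht.2, mul_pow, ← rpow_mul_natCast h1.le]
      have : ((k : ℝ) / (k + 1) - 1) * (k + 1 : ℕ) = -1 := by push_cast; field_simp; ring
      rw [this, rpow_neg_one]
    rw [setLIntegral_congr_fun measurableSet_Ioc this, setLIntegral_Ioc_ofReal hT.le]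
    · congr 1
      rw [intervalIntegral.integral_const_mul,
        intervalIntegral.integral_comp_sub_right (fun x => x⁻¹), add_sub_cancel_right,
        integral_inv_of_pos hk' (by linarith)]
      have : (moserEnd k - 1) / k =
          exp ((((k : ℝ) + 1) / k) ^ (k + 1) - ((k : ℝ) + 1) / k) := by
        unfold moserEnd; field_simp; ring
      rw [this, log_exp, mul_sub, ← mul_pow, pow_succ ((k : ℝ) / (k + 1)) k, mul_assoc]
      have : (k : ℝ) / (k + 1) * ((k + 1) / k) = 1 := by field_simp
      rw [this]; simp
    · refine continuousOn_const.mul (ContinuousOn.inv₀ (by fun_prop) ?_)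
      intro t ht
      have := ht.1
      apply ne_of_gt
      linarith
    · intro t ht
      have h1 : 0 < t - 1 := by linarith [ht.1]
      positivity
  have e3 : ∫⁻ t in Ioi (moserEnd k), ENNReal.ofReal (moserSlope k (moserEnd k) t ^ (k + 1)) = 0 := by
    refine (setLIntegral_congr_fun (g := fun _ => 0) measurableSet_Ioi fun t ht => ?_).trans (by simp)
    rw [moserSlope, if_neg (not_le.2 (hT.trans ht)), if_neg (not_le.2 ht)]
    simp
  have h1 : ((k : ℝ) / (k + 1)) ^ k ≤ 1 :=
    pow_le_one₀ (by positivity) (by rw [div_le_one (by positivity)]; linarith)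
  rw [e1, e2, e3, add_zero, ← ENNReal.ofReal_add (by positivity) (by linarith)]
  simp

theorem le_lintegral_exp_moserProfile {k : ℕ} (hk : 0 < k) :
    ENNReal.ofReal (((k : ℝ) + 1) * exp (-((3 * k + 1) / (4 * k + 2))) +
        (k * exp ((((k : ℝ) + 1) / k) ^ (k + 1) - ((k : ℝ) + 1) / k) - k) * exp (-1) + exp (-1)) ≤
      ∫⁻ t in Ioi 0, ENNReal.ofReal
        (exp (moserProfile k (moserEnd k) t ^ (((k : ℝ) + 1) / k) - t)) := by
  have hk' : (0 : ℝ) < k := by exact_mod_cast hk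
  have hT := lt_moserEnd hk
  have hTk : (k : ℝ) * exp ((((k : ℝ) + 1) / k) ^ (k + 1) - ((k : ℝ) + 1) / k) - k =
    moserEnd k - (k + 1) := by unfold moserEnd; ring
  rw [setLIntegral_Ioi_split _ (by positivity) hT, hTk, ENNReal.ofReal_add, ENNReal.ofReal_add]
  rotate_left
  · positivity
  · exact mul_nonneg (by linarith) (exp_pos _).le
  · exact add_nonneg (by positivity) (mul_nonneg (by linarith) (exp_pos _).le)
  · positivity
  have hroot (x : ℝ) (hx : 0 ≤ x) :
      (x ^ ((k : ℝ) / (k + 1))) ^ (((k : ℝ) + 1) / k) = x := by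
    rw [← rpow_mul hx, div_mul_div_cancel₀ (by positivity), div_self hk'.ne', rpow_one]
  refine add_le_add (add_le_add ?_ ?_) ?_
  · set m : ℝ := -((3 * k + 1) / (4 * k + 2)) with hm
    set p : ℝ := ((k : ℝ) + 1) / k with hp
    have hp0 : 0 < p := by positivity
    set c : ℝ := k / (k + 1 : ℝ) ^ p with hc
    have hw : ∀ t ∈ Ioc 0 ((k : ℝ) + 1),
        ENNReal.ofReal (exp (moserProfile k (moserEnd k) t ^ p - t)) =
        ENNReal.ofReal (exp (c * t ^ p - t)) := by
      intro t ht
      rw [moserProfile, if_pos ht.2, mul_rpow (by positivity) ht.1.le,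
        div_rpow (by positivity) (by positivity), hroot _ hk'.le]
    have hcont : Continuous fun t : ℝ => c * t ^ p - t := by
      have : Continuous fun t : ℝ => t ^ p := continuous_id.rpow_const fun _ => Or.inr hp0.le
      fun_prop
    rw [setLIntegral_congr_fun measurableSet_Ioc hw,
      setLIntegral_Ioc_ofReal (by positivity) hcont.rexp.continuousOn
        (fun _ _ => (exp_pos _).le)]
    refine ENNReal.ofReal_le_ofReal ?_
    have hint : ∫ t in (0 : ℝ)..(k + 1), exp m * (1 + (c * t ^ p - t) - m) = (k + 1) * exp m := by
      have i1 : IntervalIntegrable (fun t : ℝ => c * t ^ p) volume 0 (k + 1) :=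
        (Continuous.intervalIntegrable (continuous_const.mul
          (continuous_id.rpow_const fun _ => Or.inr hp0.le)) _ _)
      have i2 : IntervalIntegrable (fun t : ℝ => t) volume 0 (k + 1) :=
        continuous_id.intervalIntegrable _ _
      rw [intervalIntegral.integral_const_mul,
        intervalIntegral.integral_sub (intervalIntegrable_const.add (i1.sub i2))
          intervalIntegrable_const,
        intervalIntegral.integral_add intervalIntegrable_const (i1.sub i2),
        intervalIntegral.integral_sub i1 i2, intervalIntegral.integral_const_mul,
        integral_rpow (Or.inl (by linarith)), integral_id,
        intervalIntegral.integral_const, intervalIntegral.integral_const,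
        zero_rpow (by positivity), rpow_add (by positivity), rpow_one, hc, hm]
      have : ((k : ℝ) + 1) ^ p ≠ 0 := by positivity
      generalize ((k : ℝ) + 1) ^ p = q at *
      have h2 : p + 1 = (2 * k + 1) / k := by rw [hp]; field_simp; ring
      rw [h2]
      simp only [smul_eq_mul]
      field_simp
      ring
    rw [← hint]
    refine intervalIntegral.integral_mono_on (by positivity)
      (Continuous.intervalIntegrable (by fun_prop) _ _)
      (Continuous.intervalIntegrable (by fun_prop) _ _) fun t _ => ?_
    calc _ ≤ exp m * exp ((c * t ^ p - t) - m) := by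
          gcongr
          linarith [add_one_le_exp ((c * t ^ p - t) - m)]
      _ = _ := by rw [← exp_add]; congr 1; ring
  · rw [setLIntegral_congr_fun (g := fun _ => ENNReal.ofReal (exp (-1))) measurableSet_Ioc]
    · rw [setLIntegral_Ioc_ofReal hT.le continuousOn_const (fun _ _ => (exp_pos _).le),
        intervalIntegral.integral_const, smul_eq_mul]
    · intro t ht
      have h1 : 0 ≤ t - 1 := by linarith [ht.1]
      simp only
      rw [moserProfile, if_neg (not_le.2 ht.1), min_eq_left ht.2, hroot _ h1]
      congr 2; ring
  · rw [setLIntegral_congr_fun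
      (g := fun t => ENNReal.ofReal (exp (moserEnd k - 1) * exp (-t))) measurableSet_Ioi]
    · rw [← ofReal_integral_eq_lintegral_ofReal, integral_const_mul, integral_exp_neg_Ioi,
        ← exp_add]
      · apply le_of_eq; congr 2; ring
      · exact (integrableOn_exp_neg_Ioi (moserEnd k)).const_mul _
      · exact ae_of_all _ fun t => by simp only [Pi.zero_apply]; positivity
    · intro t ht
      simp only
      rw [moserProfile, if_neg (not_le.2 (hT.trans ht)), min_eq_right (le_of_lt ht),
        hroot _ (by linarith), ← exp_add]
      congr 2

theorem setLIntegral_Ioo_eq_Ioi {n : ℝ} (hn : 0 < n) (F : ℝ → ℝ≥0∞) :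
    ∫⁻ r in Ioo 0 1, F r =
      ∫⁻ t in Ioi 0, ENNReal.ofReal (exp (-t / n) / n) * F (exp (-t / n)) := by
  have himg : (fun t : ℝ => exp (-t / n)) '' Ioi 0 = Ioo 0 1 := by
    ext r
    constructor
    · rintro ⟨t, ht : 0 < t, rfl⟩
      refine ⟨exp_pos _, ?_⟩
      simp only [exp_lt_one_iff]
      rw [neg_div, neg_lt_zero]; positivity
    · rintro ⟨h0, h1⟩
      refine ⟨-n * log r, ?_, ?_⟩
      · have := log_neg h0 h1
        show 0 < -n * log r
        nlinarith
      · have : -(-n * log r) / n = log r := by field_simp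
        simp only [this, exp_log h0]
  rw [← himg, lintegral_image_eq_lintegral_abs_deriv_mul measurableSet_Ioi
    (f' := fun t => exp (-t / n) * (-1 / n))]
  · refine lintegral_congr fun t => ?_
    rw [abs_mul, abs_of_pos (exp_pos _), abs_div, abs_neg, abs_one, abs_of_pos hn, mul_one_div]
  · intro t _
    exact (((hasDerivAt_id t).neg.div_const n).exp).hasDerivWithinAt
  · intro x _ y _ h
    have := exp_injective h
    field_simp at this
    linarith

theorem omegaS_pos {N : ℕ} (hN : 0 < N) : 0 < omegaS N := by
  have : 0 < (volume (Metric.ball (0 : EuclideanSpace ℝ (Fin N)) 1)).toReal :=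
    ENNReal.toReal_pos (Metric.measure_ball_pos volume _ one_pos).ne' measure_ball_lt_top.ne
  unfold omegaS
  positivity

theorem cN_pos {N k : ℕ} (hN : 0 < N) (hkN : k ≤ N) : 0 < cN N k := by
  have := omegaS_pos hN
  have := Nat.choose_pos hkN
  unfold cN
  positivity

theorem cN_eq {N k : ℕ} (hN : 0 < N) (hk : 0 < k) :
    cN N k = omegaS N * ((N - 1).choose (k - 1)) / k := by
  obtain ⟨n, rfl⟩ := Nat.exists_eq_add_of_lt hN
  obtain ⟨j, rfl⟩ := Nat.exists_eq_add_of_lt hk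
  have h : (((n + 1 : ℕ) * n.choose j : ℕ) : ℝ) = ((n + 1).choose (j + 1) * (j + 1) : ℕ) :=
    congrArg _ (Nat.add_one_mul_choose_eq n j)
  push_cast at h
  simp only [cN, zero_add, Nat.add_sub_cancel]
  push_cast
  field_simp
  linear_combination -omegaS (n + 1) * h

theorem muN_pos {N k : ℕ} (hN : 0 < N) (hk : 0 < k) (hkN : k ≤ N) : 0 < muN N k := by
  have := cN_pos hN hkN
  rw [muN, ← cN_eq hN hk]
  positivity

theorem muN_pow {k : ℕ} (hk : 0 < k) :
    muN (2 * k) k ^ k = ((2 * k : ℕ) : ℝ) ^ k * cN (2 * k) k := by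
  have h := cN_pos (N := 2 * k) (k := k) (by omega) (by omega)
  rw [muN, ← cN_eq (by omega) hk, mul_pow, ← rpow_mul_natCast h.le]
  have : (2 : ℝ) / (2 * k : ℕ) * k = 1 := by push_cast; field_simp
  rw [this, rpow_one]

/-- `moserProfile` in the radial variable, scaled by `M`. -/
noncomputable def radialProfile (k : ℕ) (M r : ℝ) : ℝ :=
  M * moserProfile k (moserEnd k) (-(2 * k : ℕ) * log r)

/-- The derivative of `radialProfile`. -/
noncomputable def radialSlope (k : ℕ) (M r : ℝ) : ℝ :=
  M * (moserSlope k (moserEnd k) (-(2 * k : ℕ) * log r) * (-(2 * k : ℕ) / r))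

theorem neg_mul_log_nonneg (n : ℕ) {r : ℝ} (h0 : 0 < r) (h1 : r < 1) :
    0 ≤ -(n : ℝ) * log r := by
  have := log_neg h0 h1
  have : (0 : ℝ) ≤ n := n.cast_nonneg
  nlinarith

theorem continuousOn_radialProfile {k : ℕ} (hk : 0 < k) (M : ℝ) :
    ContinuousOn (radialProfile k M) (Ioi 0) := by
  unfold radialProfile
  refine continuousOn_const.mul ((continuous_moserProfile hk (lt_moserEnd hk)).comp_continuousOn ?_)
  exact continuousOn_const.mul (continuousOn_log.mono fun x hx => ne_of_gt hx)

theorem measurable_radialSlope (k : ℕ) (M : ℝ) : Measurable (radialSlope k M) := by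
  have := (measurable_moserSlope k (moserEnd k)).comp
    (show Measurable fun r : ℝ => -((2 * k : ℕ) : ℝ) * log r by fun_prop)
  unfold radialSlope
  exact measurable_const.mul (this.mul (by fun_prop))

theorem radialProfile_locAC {k : ℕ} (hk : 0 < k) (M : ℝ) {a b : ℝ} (ha : a ∈ Ioo (0 : ℝ) 1)
    (hb : b ∈ Ioo (0 : ℝ) 1) :
    IntervalIntegrable (radialSlope k M) volume a b ∧
      radialProfile k M b - radialProfile k M a = ∫ t in a..b, radialSlope k M t := by
  have hmin : 0 < min a b := lt_min ha.1 hb.1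
  have hn : (0 : ℝ) < (2 * k : ℕ) := by exact_mod_cast (by omega : 0 < 2 * k)
  have hii : IntervalIntegrable (radialSlope k M) volume a b := by
    rw [intervalIntegrable_iff]
    refine Measure.integrableOn_of_bounded (M := |M| * (1 * ((2 * k : ℕ) / min a b))) (by simp)
      (measurable_radialSlope k M).aestronglyMeasurable ?_
    refine (ae_restrict_iff' measurableSet_uIoc).2 (ae_of_all _ fun r hr => ?_)
    have hr' : min a b < r := hr.1
    rw [radialSlope, norm_eq_abs, abs_mul, abs_mul, abs_of_nonneg (moserSlope_nonneg _ _ _),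
      abs_div, abs_neg, abs_of_pos hn, abs_of_pos (hmin.trans hr')]
    have hr0 : 0 < r := hmin.trans hr'
    gcongr
    exact moserSlope_le_one hk _ _
  refine ⟨hii, (integral_eq_of_hasDerivAt_off_countable _ _
    (s := {exp (-(k + 1) / (2 * k : ℕ)), exp (-moserEnd k / (2 * k : ℕ))})
    (Set.toFinite _).countable ?_ ?_ hii).symm⟩
  · refine (continuousOn_radialProfile hk M).mono fun x hx => ?_
    exact hmin.trans_le hx.1
  · rintro x ⟨hx, hxs⟩
    have hx0 : 0 < x := hmin.trans hx.1
    simp only [mem_insert_iff, mem_singleton_iff, not_or] at hxs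
    have hne (c : ℝ) (h : x ≠ exp (-c / (2 * k : ℕ))) : -((2 * k : ℕ) : ℝ) * log x ≠ c := by
      rintro rfl
      apply h
      rw [← neg_mul, neg_neg, mul_div_cancel_left₀ _ hn.ne', exp_log hx0]
    have h1 := hasDerivAt_moserProfile hk (lt_moserEnd hk) (hne _ hxs.1) (hne _ hxs.2)
    have h2 := (hasDerivAt_log hx0.ne').const_mul (-((2 * k : ℕ) : ℝ))
    exact (h1.comp x h2).const_mul M

theorem radialProfile_tendsto {k : ℕ} (hk : 0 < k) (M : ℝ) :
    Tendsto (radialProfile k M) (nhdsWithin 1 (Iio 1)) (nhds 0) := by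
  have h := ((continuousOn_radialProfile hk M).continuousAt (Ioi_mem_nhds one_pos)).tendsto
  have h0 : radialProfile k M 1 = 0 := by
    have : (0 : ℝ) ≤ k + 1 := by positivity
    simp [radialProfile, moserProfile, this]
  rw [h0] at h
  exact h.mono_left nhdsWithin_le_nhds

theorem lintegral_radialSlope {k : ℕ} (hk : 0 < k) {M : ℝ} (hM : 0 < M) :
    ∫⁻ r in Ioo (0 : ℝ) 1, ENNReal.ofReal (r ^ k * |radialSlope k M r| ^ (k + 1)) =
      ENNReal.ofReal (M ^ (k + 1) * ((2 * k : ℕ) : ℝ) ^ k) := by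
  have hn : (0 : ℝ) < (2 * k : ℕ) := by exact_mod_cast (by omega : 0 < 2 * k)
  rw [setLIntegral_Ioo_eq_Ioi hn]
  have h : ∀ t : ℝ, ENNReal.ofReal (exp (-t / (2 * k : ℕ)) / (2 * k : ℕ)) *
      ENNReal.ofReal (exp (-t / (2 * k : ℕ)) ^ k *
        |radialSlope k M (exp (-t / (2 * k : ℕ)))| ^ (k + 1)) =
      ENNReal.ofReal (M ^ (k + 1) * ((2 * k : ℕ) : ℝ) ^ k) *
        ENNReal.ofReal (moserSlope k (moserEnd k) t ^ (k + 1)) := by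
    intro t
    have e : -((2 * k : ℕ) : ℝ) * log (exp (-t / (2 * k : ℕ))) = t := by
      rw [log_exp]; field_simp
    rw [radialSlope, e, ← ENNReal.ofReal_mul (by positivity), ← ENNReal.ofReal_mul (by positivity),
      abs_mul, abs_mul, abs_of_pos hM, abs_of_nonneg (moserSlope_nonneg _ _ _), abs_div, abs_neg,
      abs_of_pos hn, abs_of_pos (exp_pos _)]
    congr 1
    have := exp_pos (-t / (2 * k : ℕ))
    generalize exp (-t / (2 * k : ℕ)) = x at *
    generalize ((2 * k : ℕ) : ℝ) = n at *
    simp only [mul_pow, div_pow]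
    field_simp
    ring
  simp_rw [h]
  rw [lintegral_const_mul' _ _ ENNReal.ofReal_ne_top, lintegral_moserSlope_pow hk, mul_one]

theorem lintegral_exp_radialProfile {k : ℕ} (hk : 0 < k) {M μ : ℝ} (hM : 0 < M)
    (hμ : μ * M ^ (((k : ℝ) + 1) / k) = 1) :
    ∫⁻ r in Ioo (0 : ℝ) 1, ENNReal.ofReal
        (r ^ (2 * k - 1) * exp (μ * |radialProfile k M r| ^ (((k : ℝ) + 1) / k))) =
      ENNReal.ofReal (1 / (2 * k : ℕ)) * ∫⁻ t in Ioi 0, ENNReal.ofReal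
        (exp (moserProfile k (moserEnd k) t ^ (((k : ℝ) + 1) / k) - t)) := by
  have hn : (0 : ℝ) < (2 * k : ℕ) := by exact_mod_cast (by omega : 0 < 2 * k)
  rw [setLIntegral_Ioo_eq_Ioi hn, ← lintegral_const_mul' _ _ ENNReal.ofReal_ne_top]
  refine setLIntegral_congr_fun measurableSet_Ioi fun t ht => ?_
  have e : -((2 * k : ℕ) : ℝ) * log (exp (-t / (2 * k : ℕ))) = t := by
    rw [log_exp]; field_simp
  have hw := moserProfile_nonneg hk (lt_moserEnd hk) (le_of_lt ht)
  rw [radialProfile, e, ← ENNReal.ofReal_mul (by positivity), ← ENNReal.ofReal_mul (by positivity),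
    abs_mul, abs_of_pos hM, abs_of_nonneg hw, mul_rpow hM.le hw, ← mul_assoc μ, hμ, one_mul]
  congr 1
  have h1 : exp (-t / (2 * k : ℕ)) * exp (-t / (2 * k : ℕ)) ^ (2 * k - 1) = exp (-t) := by
    rw [← pow_succ', Nat.sub_add_cancel (by omega), ← exp_nat_mul]
    congr 1; field_simp
  rw [div_mul_eq_mul_div, ← mul_assoc, h1, ← exp_add]
  ring_nf

theorem memX1_radialProfile {k : ℕ} (hk : 0 < k) {M : ℝ} (hM : 0 < M) :
    MemX1 (2 * k) k (radialProfile k M) (radialSlope k M) where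
  locAC _ ha _ hb := radialProfile_locAC hk M ha hb
  lim_one := radialProfile_tendsto hk M
  grad_int := by
    rw [show 2 * k - k = k by omega, lintegral_radialSlope hk hM]
    exact ENNReal.ofReal_lt_top
  fun_int := by
    have h : ∀ r ∈ Ioo (0 : ℝ) 1, ENNReal.ofReal (r ^ (2 * k - 1) * |radialProfile k M r| ^ (k + 1)) ≤
        ENNReal.ofReal ((M * (moserEnd k - 1) ^ ((k : ℝ) / (k + 1))) ^ (k + 1)) := by
      intro r hr
      have hw := moserProfile_nonneg hk (lt_moserEnd hk) (neg_mul_log_nonneg (2 * k) hr.1 hr.2)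
      rw [radialProfile, abs_of_nonneg (mul_nonneg hM.le hw)]
      refine ENNReal.ofReal_le_ofReal ?_
      calc _ ≤ 1 * (M * moserProfile k (moserEnd k) (-(2 * k : ℕ) * log r)) ^ (k + 1) := by
            gcongr
            exact pow_le_one₀ hr.1.le hr.2.le
        _ ≤ _ := by
            rw [one_mul]
            gcongr
            exact moserProfile_le hk (lt_moserEnd hk)
    refine (setLIntegral_mono' measurableSet_Ioo h).trans_lt ?_
    simp

theorem normX1_radialProfile {k : ℕ} (hk : 0 < k) {M : ℝ} (hM : 0 < M)
    (h : M ^ (k + 1) * muN (2 * k) k ^ k = 1) :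
    normX1 (2 * k) k (radialSlope k M) = 1 := by
  rw [normX1, show 2 * k - k = k by omega, integral_eq_lintegral_of_nonneg_ae,
    lintegral_radialSlope hk hM, ENNReal.toReal_ofReal (by positivity)]
  · rw [muN_pow hk] at h
    rw [show cN (2 * k) k * (M ^ (k + 1) * ((2 * k : ℕ) : ℝ) ^ k) = 1 by linarith, one_rpow]
  · refine (ae_restrict_iff' measurableSet_Ioo).2 (ae_of_all _ fun r hr => ?_)
    have := hr.1
    simp only [Pi.zero_apply]
    positivity
  · have : Measurable fun r : ℝ => r ^ k * |radialSlope k M r| ^ (k + 1) :=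
      (measurable_id.pow_const k).mul ((measurable_radialSlope k M).abs.pow_const (k + 1))
    exact this.aestronglyMeasurable

theorem exists_memX1_lt_lintegral_exp {k : ℕ} (hk : 0 < k) :
    ∃ v v' : ℝ → ℝ, MemX1 (2 * k) k v v' ∧ normX1 (2 * k) k v' = 1 ∧
      ENNReal.ofReal (((1 : ℝ) / (2 * k : ℕ)) *
          (1 + exp (∑ i ∈ Finset.range k, (1 : ℝ) / (i + 1)))) <
        ∫⁻ r in Ioo (0 : ℝ) 1, ENNReal.ofReal (r ^ (2 * k - 1) *
          exp (muN (2 * k) k * |v r| ^ ((((2 * k : ℕ) : ℝ) + 2) / (2 * k : ℕ)))) := by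
  have hk' : (0 : ℝ) < k := by exact_mod_cast hk
  have hn : (0 : ℝ) < (2 * k : ℕ) := by exact_mod_cast (by omega : 0 < 2 * k)
  have hμ := muN_pos (N := 2 * k) (k := k) (by omega) hk (by omega)
  set μ := muN (2 * k) k
  set M : ℝ := μ ^ (-((k : ℝ) / (k + 1)))
  have hM : 0 < M := rpow_pos_of_pos hμ _
  have hM1 : M ^ (k + 1) * μ ^ k = 1 := by
    rw [← rpow_mul_natCast hμ.le, ← rpow_natCast μ k, ← rpow_add hμ]
    have : -((k : ℝ) / (k + 1)) * (k + 1 : ℕ) + k = 0 := by push_cast; field_simp; ring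
    rw [this, rpow_zero]
  have hM2 : μ * M ^ (((k : ℝ) + 1) / k) = 1 := by
    rw [← rpow_mul hμ.le]
    have : -((k : ℝ) / (k + 1)) * ((k + 1) / k) = -1 := by field_simp
    rw [this, rpow_neg_one, mul_inv_cancel₀ hμ.ne']
  refine ⟨radialProfile k M, radialSlope k M, memX1_radialProfile hk hM,
    normX1_radialProfile hk hM hM1, ?_⟩
  have hexp : (((2 * k : ℕ) : ℝ) + 2) / (2 * k : ℕ) = ((k : ℝ) + 1) / k := by
    push_cast; field_simp
  rw [hexp, lintegral_exp_radialProfile hk hM hM2, ENNReal.ofReal_mul (by positivity)]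
  refine ENNReal.mul_lt_mul_right (by simpa using hk.ne') ENNReal.ofReal_ne_top ?_
  refine lt_of_lt_of_le ?_ (le_lintegral_exp_moserProfile hk)
  have hlt := carleson_chang_numeric k hk
  exact (ENNReal.ofReal_lt_ofReal_iff (lt_trans (by positivity) hlt)).2 hlt

theorem stmt13 (N k : ℕ) (hk : 0 < k) (hN : N = 2 * k) :
    (∃ v v' : ℝ → ℝ, MemX1 N k v v' ∧ normX1 N k v' = 1 ∧
      ENNReal.ofReal (((1 : ℝ) / N) * (1 + exp (∑ i ∈ Finset.range k, (1 : ℝ) / (i + 1)))) <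
        ∫⁻ r in Ioo (0:ℝ) 1,
          ENNReal.ofReal (r ^ (N - 1) * exp (muN N k * |v r| ^ (((N : ℝ) + 2) / N)))) ∧
    ENNReal.ofReal (((1 : ℝ) / N) * (1 + exp (∑ i ∈ Finset.range k, (1 : ℝ) / (i + 1)))) <
      ⨆ p : {p : (ℝ → ℝ) × (ℝ → ℝ) // MemX1 N k p.1 p.2 ∧ normX1 N k p.2 = 1},
        ∫⁻ r in Ioo (0:ℝ) 1,
          ENNReal.ofReal (r ^ (N - 1) * exp (muN N k * |p.1.1 r| ^ (((N : ℝ) + 2) / N))) := by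
  subst hN
  obtain ⟨v, v', hmem, hnorm, hlt⟩ := exists_memX1_lt_lintegral_exp hk
  refine ⟨⟨v, v', hmem, hnorm, hlt⟩, hlt.trans_le ?_⟩
  exact le_iSup (fun p : {p : (ℝ → ℝ) × (ℝ → ℝ) //
      MemX1 (2 * k) k p.1 p.2 ∧ normX1 (2 * k) k p.2 = 1} =>
    ∫⁻ r in Ioo (0:ℝ) 1, ENNReal.ofReal (r ^ (2 * k - 1) *
      exp (muN (2 * k) k * |p.1.1 r| ^ ((((2 * k : ℕ) : ℝ) + 2) / (2 * k : ℕ)))))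
    ⟨(v, v'), hmem, hnorm⟩
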